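/- arXiv:2601.14151 — 3 statements merged into one kernel-verified Lean document; each statement's English description precedes it below -/
import Mathlib

section
/- Let c ≥ 1 be a real number and let f(n) = ⌈c·n⌉. Then the set of achievable burning densities is P(G(f)) = [1/(2c²), 1]. -/
open Filter Asymptotics

/-- Membership in the grid `[-f n, f n]^2 ⊆ ℤ × ℤ`. -/
def inGrid (f : ℕ → ℕ) (n : ℕ) (p : ℤ × ℤ) : Prop :=
  |p.1| ≤ (f n : ℤ) ∧ |p.2| ≤ (f n : ℤ)

instance (f : ℕ → ℕ) (n : ℕ) : DecidablePred (inGrid f n) := fun _ => by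
  unfold inGrid; infer_instance

/-- The four lattice neighbours (at `L¹`-distance one) of a point. -/
def nbrs (p : ℤ × ℤ) : Finset (ℤ × ℤ) :=
  {(p.1 + 1, p.2), (p.1 - 1, p.2), (p.1, p.2 + 1), (p.1, p.2 - 1)}

/-- An activator sequence: whenever `V n ≠ ∅` (for `n ≥ 1`), the activated vertex
lies in the grid at time `n`. -/
def IsActivator (f : ℕ → ℕ) (V : ℕ → Option (ℤ × ℤ)) : Prop :=
  ∀ n, 1 ≤ n → ∀ p, V n = some p → inGrid f n p

/-- The burning process: `B 0 = ∅`, and `B n` is obtained from `B (n-1)` by adding all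
vertices of the grid at time `n` adjacent to a vertex of `B (n-1)`, and then adding
the activator `V n` if it is not `∅`. -/
def burnSet (f : ℕ → ℕ) (V : ℕ → Option (ℤ × ℤ)) : ℕ → Finset (ℤ × ℤ)
  | 0 => ∅
  | n + 1 =>
    let B := burnSet f V n
    let spread := B ∪ (B.biUnion nbrs).filter (inGrid f (n + 1))
    match V (n + 1) with
    | none => spread
    | some v => insert v spread

/-- The proportion `|B n| / |V(G n)|` of burning vertices at time `n`. -/
noncomputable def densitySeq (f : ℕ → ℕ) (V : ℕ → Option (ℤ × ℤ)) (n : ℕ) : ℝ :=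
  ((burnSet f V n).card : ℝ) / (2 * (f n : ℝ) + 1) ^ 2

/-- The lower burning density `δ̲(G(f), V)`. -/
noncomputable def lowerDensity (f : ℕ → ℕ) (V : ℕ → Option (ℤ × ℤ)) : ℝ :=
  liminf (densitySeq f V) atTop

/-- The upper burning density `δ̄(G(f), V)`. -/
noncomputable def upperDensity (f : ℕ → ℕ) (V : ℕ → Option (ℤ × ℤ)) : ℝ :=
  limsup (densitySeq f V) atTop

/-- The burning density of `V` in `G(f)` exists and equals `ρ`. -/
def HasBurningDensity (f : ℕ → ℕ) (V : ℕ → Option (ℤ × ℤ)) (ρ : ℝ) : Prop :=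
  Tendsto (densitySeq f V) atTop (nhds ρ)

/-- `P(G(f))`: the set of `ρ ∈ [0,1]` achievable as the burning density of some
non-empty activator sequence. -/
def densSet (f : ℕ → ℕ) : Set ℝ :=
  {ρ | ρ ∈ Set.Icc (0 : ℝ) 1 ∧
    ∃ V : ℕ → Option (ℤ × ℤ), IsActivator f V ∧ (∃ t, 1 ≤ t ∧ V t ≠ none) ∧
      HasBurningDensity f V ρ}

/-- The controlled growth requirement. -/
def ControlledGrowth (f : ℕ → ℕ) : Prop :=
  (∀ᶠ n in atTop, f n < f (n + 1)) ∧
  (∀ ε : ℕ → ℕ, (fun n => (ε n : ℝ)) =o[atTop] (fun n => (n : ℝ)) →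
    Tendsto (fun n => (f (n + ε n) : ℝ) / (f n : ℝ)) atTop (nhds 1)) ∧
  (∀ c : ℝ, 0 < c → ∃ d : ℝ, 0 < d ∧
    ∀ᶠ n in atTop, (1 + d) * (f n : ℝ) ≤ (f (n + ⌈c * n⌉₊) : ℝ))

open scoped Pointwise

/-- The points of the square `[-c, c]²` of `L¹`-norm at most `a`. -/
def planeRegion (a c : ℝ) : Set (Fin 2 → ℝ) :=
  {x | |x 0| + |x 1| ≤ a ∧ |x 0| ≤ c ∧ |x 1| ≤ c}

lemma planeRegion_subset_Icc (a c : ℝ) :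
    planeRegion a c ⊆ Set.Icc (fun _ => -c) (fun _ => c) := by
  rintro x ⟨-, h0, h1⟩
  rw [abs_le] at h0 h1
  constructor <;> intro i <;> fin_cases i <;> simp_all

lemma isBounded_planeRegion (a c : ℝ) : Bornology.IsBounded (planeRegion a c) :=
  (Metric.isBounded_Icc _ _).subset (planeRegion_subset_Icc a c)

lemma isClosed_planeRegion (a c : ℝ) : IsClosed (planeRegion a c) := by
  have h (i : Fin 2) : IsClosed {x : Fin 2 → ℝ | |x i| ≤ c} :=
    isClosed_le (by fun_prop) (by fun_prop)
  have hsum : IsClosed {x : Fin 2 → ℝ | |x 0| + |x 1| ≤ a} :=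
    isClosed_le (by fun_prop) (by fun_prop)
  exact hsum.inter ((h 0).inter (h 1))

lemma convex_planeRegion (a c : ℝ) : Convex ℝ (planeRegion a c) := by
  rintro x ⟨hx, hx0, hx1⟩ y ⟨hy, hy0, hy1⟩ s t hs ht hst
  have key (i : Fin 2) : |(s • x + t • y) i| ≤ s * |x i| + t * |y i| := by
    simpa [abs_mul, abs_of_nonneg hs, abs_of_nonneg ht] using abs_add_le (s * x i) (t * y i)
  have comb {u v w : ℝ} (hu : u ≤ w) (hv : v ≤ w) : s * u + t * v ≤ w := by
    calc s * u + t * v ≤ s * w + t * w := by gcongr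
      _ = w := by rw [← add_mul, hst, one_mul]
  refine ⟨?_, (key 0).trans (comb hx0 hy0), (key 1).trans (comb hx1 hy1)⟩
  linarith [key 0, key 1, comb hx hy]

lemma volume_planeRegion_ne_top (a c : ℝ) : MeasureTheory.volume (planeRegion a c) ≠ ⊤ :=
  (isBounded_planeRegion a c).measure_lt_top.ne

/-- The area of `planeRegion a c`. -/
noncomputable def regionArea (a c : ℝ) : ℝ := MeasureTheory.volume.real (planeRegion a c)

lemma regionArea_mono {a b c : ℝ} (h : a ≤ b) : regionArea a c ≤ regionArea b c :=
  MeasureTheory.measureReal_mono (fun _ hx => ⟨hx.1.trans h, hx.2⟩)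
    (volume_planeRegion_ne_top b c)

lemma regionArea_le_div_sq_mul {a b c : ℝ} (ha : 0 < a) (h : a ≤ b) :
    regionArea b c ≤ (b / a) ^ 2 * regionArea a c := by
  have hr : 1 ≤ b / a := (one_le_div ha).2 h
  have hr0 : 0 < b / a := by positivity
  have hsub : planeRegion b c ⊆ (b / a) • planeRegion a c := by
    rintro x ⟨hx, h0, h1⟩
    rw [Set.mem_smul_set_iff_inv_smul_mem₀ hr0.ne']
    have hi : (b / a)⁻¹ ≤ 1 := inv_le_one_of_one_le₀ hr
    have hi0 : 0 ≤ (b / a)⁻¹ := by positivity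
    have hb : (b / a)⁻¹ * b = a := by
      rw [inv_div, div_mul_cancel₀ _ (ha.trans_le h).ne']
    have shrink {u : ℝ} (hu : |u| ≤ c) : (b / a)⁻¹ * |u| ≤ c :=
      (mul_le_of_le_one_left (abs_nonneg _) hi).trans hu
    refine ⟨?_, ?_, ?_⟩ <;> simp only [Pi.smul_apply, smul_eq_mul, abs_mul, abs_of_nonneg hi0]
    · rw [← mul_add]
      exact (mul_le_mul_of_nonneg_left hx hi0).trans_eq hb
    · exact shrink h0
    · exact shrink h1
  have hvol : MeasureTheory.volume.real ((b / a) • planeRegion a c) =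
      (b / a) ^ 2 * regionArea a c := by
    rw [regionArea, MeasureTheory.Measure.real, MeasureTheory.Measure.addHaar_smul,
      ENNReal.toReal_mul, ENNReal.toReal_ofReal (abs_nonneg _)]
    simp [MeasureTheory.Measure.real]
  rw [← hvol]
  exact MeasureTheory.measureReal_mono hsub
    ((isBounded_planeRegion a c).smul₀ _).measure_lt_top.ne

lemma continuousOn_regionArea (c : ℝ) :
    ContinuousOn (fun a => regionArea a c) (Set.Ioi 0) := by
  intro a ha
  apply ContinuousAt.continuousWithinAt
  have ha : 0 < a := ha
  -- squeeze between `(min a b / a)² · area` and `(max a b / a)² · area`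
  refine tendsto_of_tendsto_of_tendsto_of_le_of_le'
    (g := fun b => (min a b / a) ^ 2 * regionArea a c)
    (h := fun b => (max a b / a) ^ 2 * regionArea a c) ?_ ?_ ?_ ?_
  · have : ContinuousAt (fun b => (min a b / a) ^ 2 * regionArea a c) a := by fun_prop
    simpa [ContinuousAt, ha.ne'] using this
  · have : ContinuousAt (fun b => (max a b / a) ^ 2 * regionArea a c) a := by fun_prop
    simpa [ContinuousAt, ha.ne'] using this
  · filter_upwards [lt_mem_nhds ha] with b hb
    rcases le_total a b with h | h
    · simpa [min_eq_left h, ha.ne'] using regionArea_mono h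
    · rw [min_eq_right h]
      calc (b / a) ^ 2 * regionArea a c ≤ (b / a) ^ 2 * ((a / b) ^ 2 * regionArea b c) := by
            gcongr; exact regionArea_le_div_sq_mul hb h
        _ = regionArea b c := by field_simp
  · filter_upwards [lt_mem_nhds ha] with b hb
    rcases le_total a b with h | h
    · simpa [max_eq_right h] using regionArea_le_div_sq_mul ha h
    · simpa [max_eq_left h, ha.ne'] using regionArea_mono h

lemma regionArea_one {c : ℝ} (hc : 1 ≤ c) : regionArea 1 c = 2 := by
  have h := MeasureTheory.volume_sum_rpow_le (Fin 2) (p := 1) le_rfl 1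
  have hset : planeRegion 1 c = {x : Fin 2 → ℝ | (∑ i, |x i| ^ (1 : ℝ)) ^ (1 / (1 : ℝ)) ≤ 1} := by
    ext x
    simp only [planeRegion, Set.mem_ofPred_eq, Fin.sum_univ_two, Real.rpow_one, div_one]
    refine ⟨fun h => h.1, fun h => ⟨h, ?_, ?_⟩⟩ <;> linarith [abs_nonneg (x 0), abs_nonneg (x 1)]
  rw [regionArea, MeasureTheory.Measure.real, hset, h]
  have h2 : Real.Gamma (1 + 1) = 1 := by rw [one_add_one_eq_two, Real.Gamma_two]
  have h3 : Real.Gamma (2 + 1) = 2 := by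
    rw [Real.Gamma_add_one two_ne_zero, Real.Gamma_two, mul_one]
  simp [h2, h3]
  norm_num

lemma regionArea_two_mul {c : ℝ} (hc : 0 ≤ c) : regionArea (2 * c) c = 4 * c ^ 2 := by
  have hset : planeRegion (2 * c) c = Set.Icc (fun _ => -c) (fun _ => c) := by
    refine (planeRegion_subset_Icc _ _).antisymm fun x hx => ?_
    have h (i : Fin 2) : |x i| ≤ c := abs_le.2 ⟨hx.1 i, hx.2 i⟩
    exact ⟨by linarith [h 0, h 1], h 0, h 1⟩
  rw [regionArea, MeasureTheory.Measure.real, hset, Real.volume_Icc_pi_toReal]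
  · simp; ring
  · intro i; dsimp; linarith

lemma exists_regionArea_eq {c A : ℝ} (hc : 1 ≤ c) (hA : A ∈ Set.Icc 2 (4 * c ^ 2)) :
    ∃ a, 1 ≤ a ∧ regionArea a c = A := by
  have hc0 : 0 ≤ c := by linarith
  have hcont : ContinuousOn (fun a => regionArea a c) (Set.Icc 1 (2 * c)) :=
    (continuousOn_regionArea c).mono fun x hx => zero_lt_one.trans_le hx.1
  have := intermediate_value_Icc (by linarith) hcont
  rw [regionArea_one hc, regionArea_two_mul hc0] at this
  obtain ⟨a, ha, rfl⟩ := this hA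
  exact ⟨a, ha.1, rfl⟩

/-- The lattice points of the `n`-fold dilate of `planeRegion a c`. -/
noncomputable def latticeRegion (a c : ℝ) (n : ℕ) : Finset (ℤ × ℤ) :=
  (Finset.Icc (-⌊c * n⌋) ⌊c * n⌋ ×ˢ Finset.Icc (-⌊c * n⌋) ⌊c * n⌋).filter
    fun p => ((|p.1| + |p.2| : ℤ) : ℝ) ≤ a * n

lemma mem_latticeRegion {a c : ℝ} {n : ℕ} {p : ℤ × ℤ} :
    p ∈ latticeRegion a c n ↔ (|(p.1 : ℝ)| + |(p.2 : ℝ)| ≤ a * n) ∧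
      |(p.1 : ℝ)| ≤ c * n ∧ |(p.2 : ℝ)| ≤ c * n := by
  have h (z : ℤ) : -⌊c * n⌋ ≤ z ∧ z ≤ ⌊c * n⌋ ↔ |(z : ℝ)| ≤ c * n := by
    rw [← abs_le, Int.le_floor, Int.cast_abs]
  simp only [latticeRegion, Finset.mem_filter, Finset.mem_product, Finset.mem_Icc, h]
  push_cast
  tauto

lemma card_latticeRegion (a c : ℝ) {n : ℕ} (hn : n ≠ 0) :
    (latticeRegion a c n).card = Nat.card ↑(planeRegion a c ∩
      (n : ℝ)⁻¹ • (Submodule.span ℤ (Set.range (Pi.basisFun ℝ (Fin 2))) : Set (Fin 2 → ℝ))) := by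
  have hn' : (0 : ℝ) < n := by positivity
  set φ : ℤ × ℤ → Fin 2 → ℝ := fun p => (n : ℝ)⁻¹ • ![(p.1 : ℝ), (p.2 : ℝ)]
  have hφ : Function.Injective φ := by
    intro p q h
    have h' := smul_right_injective (Fin 2 → ℝ) (inv_ne_zero hn'.ne') h
    exact Prod.ext (by simpa using congrFun h' 0) (by simpa using congrFun h' 1)
  have hmem (p : ℤ × ℤ) : φ p ∈ planeRegion a c ↔ p ∈ latticeRegion a c n := by
    simp only [mem_latticeRegion, planeRegion, Set.mem_ofPred_eq, φ, Pi.smul_apply, smul_eq_mul,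
      abs_mul, abs_inv, Nat.abs_cast, ← mul_add, inv_mul_le_iff₀ hn']
    simp [mul_comm]
  rw [Nat.card_coe_set_eq, ← Set.ncard_coe_finset, ← Set.ncard_image_of_injective _ hφ]
  congr 1
  ext x
  constructor
  · rintro ⟨p, hp, rfl⟩
    refine ⟨(hmem p).2 hp, Set.smul_mem_smul_set ?_⟩
    rw [SetLike.mem_coe, Module.Basis.mem_span_iff_repr_mem]
    intro i
    fin_cases i <;> simp
  · rintro ⟨hx, y, hy, rfl⟩
    rw [SetLike.mem_coe, Module.Basis.mem_span_iff_repr_mem] at hy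
    obtain ⟨u, hu⟩ := hy 0
    obtain ⟨v, hv⟩ := hy 1
    have hxy : φ (u, v) = (n : ℝ)⁻¹ • y := by
      refine congrArg ((n : ℝ)⁻¹ • ·) (funext fun i => ?_)
      fin_cases i
      · exact hu
      · exact hv
    exact ⟨(u, v), (hmem _).1 (hxy ▸ hx), hxy⟩

lemma tendsto_card_latticeRegion (a c : ℝ) :
    Tendsto (fun n : ℕ => ((latticeRegion a c n).card : ℝ) / n ^ 2) atTop
      (nhds (regionArea a c)) := by
  refine (tendsto_card_div_pow_atTop_volume (planeRegion a c) (isBounded_planeRegion a c)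
    (isClosed_planeRegion a c).measurableSet
    ((convex_planeRegion a c).addHaar_frontier _)).congr' ?_
  filter_upwards [eventually_ne_atTop 0] with n hn
  rw [card_latticeRegion a c hn, Fintype.card_fin]

lemma burnSet_subset_succ (f : ℕ → ℕ) (V : ℕ → Option (ℤ × ℤ)) (n : ℕ) :
    burnSet f V n ⊆ burnSet f V (n + 1) := by
  intro p hp
  simp only [burnSet]
  split <;> simp [hp]

lemma mem_burnSet_succ_of_mem_nbrs {f : ℕ → ℕ} {V : ℕ → Option (ℤ × ℤ)} {n : ℕ} {p q : ℤ × ℤ}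
    (hq : q ∈ burnSet f V n) (hp : p ∈ nbrs q) (hg : inGrid f (n + 1) p) :
    p ∈ burnSet f V (n + 1) := by
  have : p ∈ burnSet f V n ∪ ((burnSet f V n).biUnion nbrs).filter (inGrid f (n + 1)) :=
    Finset.mem_union_right _ (Finset.mem_filter.2 ⟨Finset.mem_biUnion.2 ⟨q, hq, hp⟩, hg⟩)
  simp only [burnSet]
  split
  · exact this
  · exact Finset.mem_insert_of_mem this

lemma mem_burnSet_activator {f : ℕ → ℕ} {V : ℕ → Option (ℤ × ℤ)} {t : ℕ} {v : ℤ × ℤ}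
    (ht : 1 ≤ t) (hv : V t = some v) : v ∈ burnSet f V t := by
  obtain ⟨t, rfl⟩ := Nat.exists_eq_add_of_le' ht
  simp [burnSet, hv]

lemma exists_nbrs_closer {v p : ℤ × ℤ} {d : ℕ} (h : |p.1 - v.1| + |p.2 - v.2| = d + 1) :
    ∃ q, p ∈ nbrs q ∧ |q.1 - v.1| + |q.2 - v.2| ≤ d := by
  obtain ⟨x, y⟩ := v
  obtain ⟨p, q⟩ := p
  simp only [nbrs, Finset.mem_insert, Finset.mem_singleton, Prod.mk.injEq, Prod.exists] at *
  rcases lt_trichotomy p x with hx | rfl | hx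
  · exact ⟨p + 1, q, by omega, by simp only [abs, max_def] at *; split_ifs at * <;> omega⟩
  · rcases lt_trichotomy q y with hy | rfl | hy
    · exact ⟨p, q + 1, by omega, by simp only [abs, max_def] at *; split_ifs at * <;> omega⟩
    · simp at h; omega
    · exact ⟨p, q - 1, by omega, by simp only [abs, max_def] at *; split_ifs at * <;> omega⟩
  · exact ⟨p - 1, q, by omega, by simp only [abs, max_def] at *; split_ifs at * <;> omega⟩

/-- If the grid grows at least at unit speed, it never obstructs the spread of a fire. -/
lemma ball_subset_burnSet {f : ℕ → ℕ} (hf : ∀ n, f n + 1 ≤ f (n + 1))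
    {V : ℕ → Option (ℤ × ℤ)} {t : ℕ} {v : ℤ × ℤ} (ht : 1 ≤ t) (hv : V t = some v)
    (hg : inGrid f t v) (d : ℕ) {p : ℤ × ℤ} (hp : |p.1 - v.1| + |p.2 - v.2| ≤ d) :
    p ∈ burnSet f V (t + d) := by
  have hfd (d : ℕ) : f t + d ≤ f (t + d) := by
    induction d with
    | zero => rfl
    | succ d ih => have := hf (t + d); rw [← add_assoc t]; omega
  induction d generalizing p with
  | zero =>
    have h1 := abs_nonneg (p.1 - v.1)
    have h2 := abs_nonneg (p.2 - v.2)
    have e1 : p.1 - v.1 = 0 := abs_eq_zero.1 (by push_cast at hp; omega)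
    have e2 : p.2 - v.2 = 0 := abs_eq_zero.1 (by push_cast at hp; omega)
    rw [show p = v from Prod.ext (by omega) (by omega)]
    exact mem_burnSet_activator ht hv
  | succ d ih =>
    rcases lt_or_ge (d : ℤ) (|p.1 - v.1| + |p.2 - v.2|) with h | h
    · obtain ⟨q, hpq, hq⟩ :=
        exists_nbrs_closer (v := v) (p := p) (d := d) (by push_cast at hp; omega)
      refine mem_burnSet_succ_of_mem_nbrs (n := t + d) (ih hq) hpq ?_
      have : f t + (d + 1) ≤ f (t + d + 1) := hfd (d + 1)
      obtain ⟨g1, g2⟩ := hg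
      constructor <;> rw [abs_le] at * <;> simp only [abs, max_def] at hp <;> split_ifs at hp <;>
        omega
    · exact burnSet_subset_succ f V _ (ih h)

lemma burnSet_subset_latticeRegion {f : ℕ → ℕ} {V : ℕ → Option (ℤ × ℤ)} {a c : ℝ}
    (ha : 1 ≤ a) (hc : 1 ≤ c) (hV : ∀ t, 1 ≤ t → ∀ v, V t = some v → v ∈ latticeRegion a c t)
    (n : ℕ) : burnSet f V n ⊆ latticeRegion a c n := by
  have habs (z : ℤ) :
      |((z + 1 : ℤ) : ℝ)| ≤ |(z : ℝ)| + 1 ∧ |((z - 1 : ℤ) : ℝ)| ≤ |(z : ℝ)| + 1 := by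
    push_cast
    exact ⟨by simpa using abs_add_le (z : ℝ) 1, by simpa using abs_sub (z : ℝ) 1⟩
  induction n with
  | zero => simp [burnSet]
  | succ n ih =>
    have hspread : burnSet f V n ∪ ((burnSet f V n).biUnion nbrs).filter (inGrid f (n + 1)) ⊆
        latticeRegion a c (n + 1) := by
      intro p hp
      rw [Finset.mem_union, Finset.mem_filter, Finset.mem_biUnion] at hp
      rw [mem_latticeRegion]
      push_cast
      rcases hp with hp | ⟨⟨q, hq, hp⟩, -⟩
      · have := mem_latticeRegion.1 (ih hp)
        refine ⟨?_, ?_, ?_⟩ <;> linarith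
      · have := mem_latticeRegion.1 (ih hq)
        have h1 := habs q.1
        have h2 := habs q.2
        simp only [nbrs, Finset.mem_insert, Finset.mem_singleton] at hp
        rcases hp with rfl | rfl | rfl | rfl <;> refine ⟨?_, ?_, ?_⟩ <;> dsimp only <;> linarith
    simp only [burnSet]
    split
    · exact hspread
    · next v hv => exact Finset.insert_subset (hV _ (by omega) v hv) hspread

lemma padicValNat_two_recurrent (j N : ℕ) :
    ∃ t, N < t ∧ t ≤ N + 2 ^ (j + 2) ∧ padicValNat 2 t = j := by
  refine ⟨2 ^ j * (2 * (N / 2 ^ (j + 1) + 1) + 1), ?_, ?_, ?_⟩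
  · have := Nat.lt_mul_div_succ N (show 0 < 2 ^ (j + 1) by positivity)
    rw [pow_succ] at *
    nlinarith [Nat.one_le_two_pow (n := j)]
  · have := Nat.mul_div_le N (2 ^ (j + 1))
    rw [pow_succ] at *
    rw [pow_succ, pow_succ]
    nlinarith [Nat.one_le_two_pow (n := j)]
  · rw [padicValNat.mul (by positivity) (by omega), padicValNat.prime_pow,
      padicValNat.eq_zero_of_not_dvd (by omega), add_zero]

/-- An activator sequence that returns, with bounded gaps, to the direction of every rational
point of `planeRegion a c`. -/
noncomputable def recurrentActivator (a c : ℝ) (t : ℕ) : Option (ℤ × ℤ) :=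
  let e := Denumerable.ofNat (ℕ × ℤ × ℤ) (padicValNat 2 t)
  if e.2 ∈ latticeRegion a c e.1 then
    some (((t / e.1 : ℕ) : ℤ) * e.2.1, ((t / e.1 : ℕ) : ℤ) * e.2.2)
  else none

lemma recurrentActivator_mem {a c : ℝ} (ha : 0 ≤ a) (hc : 0 ≤ c) {t : ℕ} {v : ℤ × ℤ}
    (hv : recurrentActivator a c t = some v) : v ∈ latticeRegion a c t := by
  simp only [recurrentActivator] at hv
  split_ifs at hv with h
  obtain rfl := Option.some.inj hv
  set e := Denumerable.ofNat (ℕ × ℤ × ℤ) (padicValNat 2 t)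
  rw [mem_latticeRegion] at h ⊢
  obtain ⟨h0, h1, h2⟩ := h
  have hdiv : ((t / e.1 : ℕ) : ℝ) * e.1 ≤ t := by exact_mod_cast Nat.div_mul_le_self t e.1
  have hq : (0 : ℝ) ≤ ((t / e.1 : ℕ) : ℝ) := by positivity
  have key {u b : ℝ} (hb : 0 ≤ b) (hu : u ≤ b * e.1) : ((t / e.1 : ℕ) : ℝ) * u ≤ b * t := by
    calc ((t / e.1 : ℕ) : ℝ) * u ≤ ((t / e.1 : ℕ) : ℝ) * (b * e.1) := by gcongr
      _ = b * (((t / e.1 : ℕ) : ℝ) * e.1) := by ring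
      _ ≤ b * t := by gcongr
  simp only [Int.cast_mul, Int.cast_natCast, abs_mul, Nat.abs_cast, ← mul_add]
  exact ⟨key ha h0, key hc h1, key hc h2⟩

lemma exists_recurrentActivator_eq (a c : ℝ) (k : ℕ) :
    ∃ L : ℕ, ∀ N, ∀ q ∈ latticeRegion a c k, ∃ t, N < t ∧ t ≤ N + L ∧
      recurrentActivator a c t = some (((t / k : ℕ) : ℤ) * q.1, ((t / k : ℕ) : ℤ) * q.2) := by
  refine ⟨(latticeRegion a c k).sup fun q => 2 ^ (Encodable.encode (k, q) + 2), fun N q hq => ?_⟩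
  obtain ⟨t, h1, h2, h3⟩ := padicValNat_two_recurrent (Encodable.encode (k, q)) N
  refine ⟨t, h1, h2.trans (Nat.add_le_add_left ?_ N), ?_⟩
  · exact Finset.le_sup (f := fun q => 2 ^ (Encodable.encode (k, q) + 2)) hq
  · simp only [recurrentActivator, h3, Denumerable.ofNat_encode, if_pos hq]

/-- Rounding `x` towards zero on the scale `N / k`. -/
lemma exists_int_approx (x : ℝ) {N k : ℝ} (hN : 0 < N) (hk : 0 < k) :
    ∃ z : ℤ, |(z : ℝ)| * N ≤ |x| * k ∧ |x - N / k * z| ≤ N / k := by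
  wlog hx : 0 ≤ x generalizing x
  · obtain ⟨z, h1, h2⟩ := this (-x) (by linarith)
    refine ⟨-z, by simpa using h1, ?_⟩
    rw [← abs_neg] at h2
    convert h2 using 2
    push_cast; ring
  refine ⟨⌊x * k / N⌋, ?_, ?_⟩
  · have h0 : (0 : ℝ) ≤ ⌊x * k / N⌋ := by exact_mod_cast Int.floor_nonneg.2 (by positivity)
    rw [abs_of_nonneg h0, abs_of_nonneg hx, ← le_div_iff₀ hN]
    exact Int.floor_le _
  · have h1 := Int.floor_le (x * k / N)
    have h2 := (Int.lt_floor_add_one (x * k / N)).le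
    have hNk : 0 < N / k := by positivity
    have e : N / k * (x * k / N) = x := by field_simp
    have h1' := mul_le_mul_of_nonneg_left h1 hNk.le
    have h2' := mul_le_mul_of_nonneg_left h2 hNk.le
    rw [abs_le]
    constructor <;> linarith

lemma abs_sub_natDiv_mul_le {c x z : ℝ} {N L t k : ℕ} (hk : 0 < k) (ht : N < t) (ht' : t ≤ N + L)
    (hz : |z| ≤ c * k) (hx : |x - N / k * z| ≤ N / k) :
    |x - ((t / k : ℕ) : ℝ) * z| ≤ N / k + c * (L + k) := by
  have hk' : (0 : ℝ) < k := by exact_mod_cast hk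
  have hq1 : ((t / k : ℕ) : ℝ) ≤ t / k := Nat.cast_div_le
  have hq2 : (t : ℝ) / k < ((t / k : ℕ) : ℝ) + 1 := by
    rw [div_lt_iff₀ hk']; exact_mod_cast Nat.lt_mul_of_div_lt (Nat.lt_succ_self _) hk
  have hd : |(N : ℝ) / k - ((t / k : ℕ) : ℝ)| ≤ (L + k) / k := by
    have ht1 : (N : ℝ) / k ≤ t / k := by gcongr
    have ht2 : (t : ℝ) / k ≤ N / k + L / k := by
      rw [← add_div]; gcongr; exact_mod_cast ht'
    have hL : (0 : ℝ) ≤ L / k := by positivity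
    rw [add_div, div_self hk'.ne', abs_le]
    constructor <;> linarith
  calc |x - ((t / k : ℕ) : ℝ) * z|
      = |(x - N / k * z) + (N / k - ((t / k : ℕ) : ℝ)) * z| := by ring_nf
    _ ≤ |x - N / k * z| + |(N : ℝ) / k - ((t / k : ℕ) : ℝ)| * |z| := by
        rw [← abs_mul]; exact abs_add_le _ _
    _ ≤ N / k + (L + k) / k * (c * k) := by gcongr
    _ = N / k + c * (L + k) := by field_simp

lemma inGrid_of_mem_latticeRegion {a c : ℝ} {f : ℕ → ℕ} (hf : ∀ n, f n = ⌈c * (n : ℝ)⌉₊) {n : ℕ}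
    {p : ℤ × ℤ} (hp : p ∈ latticeRegion a c n) : inGrid f n p := by
  have h {z : ℤ} (hz : |(z : ℝ)| ≤ c * n) : |z| ≤ (f n : ℤ) := by
    have := hz.trans (Nat.le_ceil _)
    rw [hf]
    exact_mod_cast this
  obtain ⟨-, h1, h2⟩ := mem_latticeRegion.1 hp
  exact ⟨h h1, h h2⟩

lemma ceil_mul_add_one_le {c : ℝ} (hc : 1 ≤ c) {f : ℕ → ℕ} (hf : ∀ n, f n = ⌈c * (n : ℝ)⌉₊)
    (n : ℕ) : f n + 1 ≤ f (n + 1) := by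
  rw [hf, hf, ← Nat.ceil_add_one (by positivity)]
  apply Nat.ceil_mono
  push_cast
  linarith

lemma exists_latticeRegion_subset_burnSet {a c : ℝ} (hc : 1 ≤ c) (ha : 0 ≤ a) {f : ℕ → ℕ}
    (hf : ∀ n, f n = ⌈c * (n : ℝ)⌉₊) {k : ℕ} (hk : 0 < k) :
    ∃ C : ℝ, ∀ N n : ℕ, 0 < N → (1 + 2 / k) * (N : ℝ) + C ≤ n →
      latticeRegion a c N ⊆ burnSet f (recurrentActivator a c) n := by
  obtain ⟨L, hL⟩ := exists_recurrentActivator_eq a c k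
  refine ⟨L + 2 * (c * (L + k)), fun N n hN hn p hp => ?_⟩
  have hN' : (0 : ℝ) < N := by exact_mod_cast hN
  have hk' : (0 : ℝ) < k := by exact_mod_cast hk
  obtain ⟨x, hx, hx'⟩ := exists_int_approx p.1 hN' hk'
  obtain ⟨y, hy, hy'⟩ := exists_int_approx p.2 hN' hk'
  have hq : ((x, y) : ℤ × ℤ) ∈ latticeRegion a c k := by
    obtain ⟨h0, h1, h2⟩ := mem_latticeRegion.1 hp
    have key {u v b : ℝ} (h : u * N ≤ v * k) (hv : v ≤ b * N) : u ≤ b * k := by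
      refine le_of_mul_le_mul_right (h.trans ?_) hN'
      calc v * k ≤ b * N * k := by gcongr
        _ = b * k * N := by ring
    exact mem_latticeRegion.2
      ⟨key (by rw [add_mul, add_mul]; exact add_le_add hx hy) h0, key hx h1, key hy h2⟩
  obtain ⟨-, hxc, hyc⟩ := mem_latticeRegion.1 hq
  obtain ⟨t, ht, ht', hv⟩ := hL N _ hq
  have hd1 := abs_sub_natDiv_mul_le hk ht ht' hxc hx'
  have hd2 := abs_sub_natDiv_mul_le hk ht ht' hyc hy'
  have htL : (t : ℝ) ≤ N + L := by exact_mod_cast ht'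
  have hdist :
      |(p.1 : ℝ) - ((t / k : ℕ) : ℝ) * x| + |(p.2 : ℝ) - ((t / k : ℕ) : ℝ) * y| + t ≤ n := by
    have : 2 / (k : ℝ) * N = N / k + N / k := by ring
    linarith
  have htn : t ≤ n := by
    have : (t : ℝ) ≤ n := le_trans (by simp; positivity) hdist
    exact_mod_cast this
  obtain ⟨d, rfl⟩ := Nat.exists_eq_add_of_le htn
  refine ball_subset_burnSet (ceil_mul_add_one_le hc hf) (by omega) hv
    (inGrid_of_mem_latticeRegion hf (recurrentActivator_mem ha (by linarith) hv)) d ?_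
  push_cast at hdist
  have : |(p.1 : ℝ) - ((t / k : ℕ) : ℝ) * x| + |(p.2 : ℝ) - ((t / k : ℕ) : ℝ) * y| ≤ d := by
    linarith
  dsimp only
  generalize t / k = m at this ⊢
  exact_mod_cast this

lemma tendsto_card_burnSet_recurrentActivator {a c : ℝ} (ha : 1 ≤ a) (hc : 1 ≤ c) {f : ℕ → ℕ}
    (hf : ∀ n, f n = ⌈c * (n : ℝ)⌉₊) :
    Tendsto (fun n : ℕ => ((burnSet f (recurrentActivator a c) n).card : ℝ) / n ^ 2) atTop
      (nhds (regionArea a c)) := by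
  have hr := tendsto_card_latticeRegion a c
  rw [tendsto_order]
  constructor
  · intro b hb
    obtain ⟨θ, ⟨hθ0, hθ1⟩, hθ⟩ : ∃ θ ∈ Set.Ioo (0 : ℝ) 1, b < regionArea a c * θ ^ 2 := by
      have hcont : Tendsto (fun θ : ℝ => regionArea a c * θ ^ 2) (nhdsWithin 1 (Set.Iio 1))
          (nhds (regionArea a c)) := by
        have : ContinuousAt (fun θ : ℝ => regionArea a c * θ ^ 2) 1 := by fun_prop
        simpa using this.tendsto.mono_left nhdsWithin_le_nhds
      exact (Filter.Eventually.and (Ioo_mem_nhdsLT zero_lt_one)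
        (hcont.eventually (lt_mem_nhds hb))).exists
    obtain ⟨k, hk⟩ := exists_nat_gt (2 / (1 / θ - 1))
    have hθ' : 0 < 1 / θ - 1 := by rw [sub_pos, lt_div_iff₀ hθ0]; linarith
    have hk0 : (0 : ℝ) < k := lt_trans (by positivity) hk
    have hkθ : (1 + 2 / k) * θ < 1 := by
      rw [div_lt_iff₀ hθ', mul_comm, ← div_lt_iff₀ hk0] at hk
      rw [← lt_div_iff₀ hθ0]; linarith
    obtain ⟨C, hC⟩ := exists_latticeRegion_subset_burnSet (a := a) hc (by linarith) hf
      (k := k) (by exact_mod_cast hk0)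
    have hfloor : Tendsto (fun n : ℕ => ⌊θ * (n : ℝ)⌋₊) atTop atTop :=
      tendsto_nat_floor_atTop.comp (tendsto_natCast_atTop_atTop.const_mul_atTop hθ0)
    have hratio : Tendsto (fun n : ℕ => (⌊θ * (n : ℝ)⌋₊ : ℝ) / n) atTop (nhds θ) :=
      (tendsto_nat_floor_mul_div_atTop hθ0.le).comp tendsto_natCast_atTop_atTop
    have hlim := (hr.comp hfloor).mul (hratio.pow 2)
    have hlarge : ∀ᶠ n : ℕ in atTop, C ≤ (1 - (1 + 2 / k) * θ) * (n : ℝ) :=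
      (tendsto_natCast_atTop_atTop.const_mul_atTop (by linarith)).eventually_ge_atTop C
    filter_upwards [hlim.eventually (lt_mem_nhds hθ), hlarge, hfloor.eventually_gt_atTop 0,
      eventually_gt_atTop 0] with n hn hn1 hn2 hn0
    have hn0' : (0 : ℝ) < n := by exact_mod_cast hn0
    refine hn.trans_le ?_
    have hsub := Finset.card_le_card (hC ⌊θ * (n : ℝ)⌋₊ n hn2 (by
      have h1 : (⌊θ * (n : ℝ)⌋₊ : ℝ) ≤ θ * n := Nat.floor_le (by positivity)
      have h2 := mul_le_mul_of_nonneg_left h1 (show 0 ≤ 1 + 2 / (k : ℝ) by positivity)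
      linarith))
    have hn2' : (⌊θ * (n : ℝ)⌋₊ : ℝ) ≠ 0 := by exact_mod_cast hn2.ne'
    rw [Function.comp_apply, div_pow, div_mul_div_cancel₀ (pow_ne_zero 2 hn2')]
    gcongr
  · intro b hb
    filter_upwards [hr.eventually (gt_mem_nhds hb)] with n hn
    refine lt_of_le_of_lt ?_ hn
    gcongr
    exact burnSet_subset_latticeRegion ha hc
      (fun t _ v hv => recurrentActivator_mem (by linarith) (by linarith) hv) n

lemma tendsto_side_div {c : ℝ} (hc : 0 ≤ c) {f : ℕ → ℕ} (hf : ∀ n, f n = ⌈c * (n : ℝ)⌉₊) :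
    Tendsto (fun n : ℕ => (2 * (f n : ℝ) + 1) / n) atTop (nhds (2 * c)) := by
  have h1 : Tendsto (fun n : ℕ => (⌈c * (n : ℝ)⌉₊ : ℝ) / n) atTop (nhds c) :=
    (tendsto_nat_ceil_mul_div_atTop hc).comp tendsto_natCast_atTop_atTop
  have h2 := (h1.const_mul 2).add tendsto_one_div_atTop_nhds_zero_nat
  rw [add_zero] at h2
  refine h2.congr fun n => ?_
  rw [hf]; ring

lemma hasBurningDensity_of_tendsto {c A : ℝ} (hc : 0 < c) {f : ℕ → ℕ}
    (hf : ∀ n, f n = ⌈c * (n : ℝ)⌉₊) {V : ℕ → Option (ℤ × ℤ)}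
    (h : Tendsto (fun n : ℕ => ((burnSet f V n).card : ℝ) / n ^ 2) atTop (nhds A)) :
    HasBurningDensity f V (A / (2 * c) ^ 2) := by
  refine (h.div ((tendsto_side_div hc.le hf).pow 2) (by positivity)).congr' ?_
  filter_upwards [eventually_ne_atTop 0] with n hn
  simp only [Pi.div_apply, densitySeq]
  have : (n : ℝ) ≠ 0 := by exact_mod_cast hn
  field_simp

lemma le_of_hasBurningDensity {c ρ : ℝ} (hc : 1 ≤ c) {f : ℕ → ℕ}
    (hf : ∀ n, f n = ⌈c * (n : ℝ)⌉₊) {V : ℕ → Option (ℤ × ℤ)} (hV : IsActivator f V) {t : ℕ}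
    (ht : 1 ≤ t) (hVt : V t ≠ none) (h : HasBurningDensity f V ρ) : 1 / (2 * c ^ 2) ≤ ρ := by
  obtain ⟨v, hv⟩ := Option.ne_none_iff_exists'.1 hVt
  have hcard (d : ℕ) : (latticeRegion 1 c d).card ≤ (burnSet f V (t + d)).card := by
    refine Finset.card_le_card_of_injOn (· + v) (fun p hp => ?_) (add_left_injective v).injOn
    have := (mem_latticeRegion.1 hp).1
    refine ball_subset_burnSet (ceil_mul_add_one_le hc hf) ht hv (hV t ht v hv) d ?_
    simp only [Prod.fst_add, Prod.snd_add, add_sub_cancel_right]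
    rw [one_mul] at this
    exact_mod_cast this
  have hshift : Tendsto (fun d : ℕ => t + d) atTop atTop := 
    tendsto_atTop_mono (Nat.le_add_left · t) tendsto_id
  have hside : Tendsto (fun d : ℕ => (2 * (f (t + d) : ℝ) + 1) / d) atTop (nhds (2 * c)) := by
    have h1 : Tendsto (fun d : ℕ => ((t + d : ℕ) : ℝ) / d) atTop (nhds 1) := by
      have := (tendsto_const_div_atTop_nhds_zero_nat (t : ℝ)).add_const 1
      rw [zero_add] at this
      refine this.congr' ?_
      filter_upwards [eventually_ne_atTop 0] with d hd
      have : (d : ℝ) ≠ 0 := by exact_mod_cast hd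
      push_cast
      field_simp
    have := ((tendsto_side_div (by linarith) hf).comp hshift).mul h1
    rw [mul_one] at this
    refine this.congr' ?_
    filter_upwards [eventually_ne_atTop 0] with d hd
    have : ((t + d : ℕ) : ℝ) ≠ 0 := by exact_mod_cast (by omega)
    exact div_mul_div_cancel₀ this
  have hlow := (tendsto_card_latticeRegion 1 c).div (hside.pow 2) (by positivity)
  rw [regionArea_one hc] at hlow
  have hle := le_of_tendsto_of_tendsto hlow (h.comp hshift) (by
    filter_upwards [eventually_ne_atTop 0] with d hd
    have hd' : (d : ℝ) ≠ 0 := by exact_mod_cast hd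
    simp only [Pi.div_apply, Function.comp_apply, densitySeq]
    rw [div_pow, div_div_div_cancel_right₀ (pow_ne_zero 2 hd')]
    exact div_le_div_of_nonneg_right (by exact_mod_cast hcard d) (by positivity))
  refine le_of_eq_of_le ?_ hle
  have : c ≠ 0 := by positivity
  field_simp

/-- if `f(n) = ⌈c n⌉` with `c ≥ 1`, then `P(G(f)) = [1/(2c²), 1]`. -/
theorem burning_density_linear (c : ℝ) (hc : 1 ≤ c) (f : ℕ → ℕ)
    (hf : ∀ n, f n = ⌈c * (n : ℝ)⌉₊) :
    densSet f = Set.Icc (1 / (2 * c ^ 2)) 1 := by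
  have hc0 : 0 < c := by linarith
  ext ρ
  constructor
  · rintro ⟨⟨-, h1⟩, V, hV, ⟨t, ht, hVt⟩, h⟩
    exact ⟨le_of_hasBurningDensity hc hf hV ht hVt h, h1⟩
  · rintro ⟨h0, h1⟩
    have hA : ρ * (2 * c) ^ 2 ∈ Set.Icc 2 (4 * c ^ 2) := by
      rw [div_le_iff₀ (by positivity)] at h0
      constructor <;> nlinarith [sq_nonneg c]
    obtain ⟨a, ha, haA⟩ := exists_regionArea_eq hc hA
    refine ⟨⟨le_trans (by positivity) h0, h1⟩, recurrentActivator a c, ?_, ?_, ?_⟩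
    · exact fun n _ p hp => inGrid_of_mem_latticeRegion hf
        (recurrentActivator_mem (by linarith) hc0.le hp)
    · obtain ⟨L, hL⟩ := exists_recurrentActivator_eq a c 1
      obtain ⟨t, ht, -, hv⟩ := hL 0 (0, 0) (by simp [mem_latticeRegion]; constructor <;> linarith)
      exact ⟨t, ht, by simp [hv]⟩
    · have := hasBurningDensity_of_tendsto hc0 hf (tendsto_card_burnSet_recurrentActivator ha hc hf)
      rwa [haA, mul_div_cancel_right₀ _ (by positivity)] at this
end

section
/- Let c > 0 be a real number, let α ∈ (1, 3/2), and let f(n) = ⌈c·n^α⌉. Then the set of achievable burning densities is P(G(f)) = [0, 1]. -/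
open Filter Asymptotics

/-- The square `[-r, r]² ⊆ ℤ × ℤ`. -/
noncomputable def box (r : ℕ) : Finset (ℤ × ℤ) :=
  Finset.Icc (-(r : ℤ)) r ×ˢ Finset.Icc (-(r : ℤ)) r

lemma mem_box {r : ℕ} {p : ℤ × ℤ} : p ∈ box r ↔ |p.1| ≤ r ∧ |p.2| ≤ r := by
  simp [box, abs_le]

lemma card_box (r : ℕ) : (box r).card = (2 * r + 1) ^ 2 := by
  have h : ((r : ℤ) + 1 - -(r : ℤ)).toNat = 2 * r + 1 := by omega
  rw [box, Finset.card_product, Int.card_Icc, h, sq]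

lemma mem_burnSet_succ {f : ℕ → ℕ} {V : ℕ → Option (ℤ × ℤ)} {n : ℕ} {p : ℤ × ℤ} :
    p ∈ burnSet f V (n + 1) ↔ V (n + 1) = some p ∨ p ∈ burnSet f V n ∨
      ((∃ p' ∈ burnSet f V n, p ∈ nbrs p') ∧ inGrid f (n + 1) p) := by
  rw [burnSet]
  cases h : V (n + 1) <;> simp [eq_comm]

lemma burnSet_mono (f : ℕ → ℕ) (V : ℕ → Option (ℤ × ℤ)) : Monotone (burnSet f V) :=
  monotone_nat_of_le_succ fun _ _ hp => mem_burnSet_succ.2 (.inr (.inl hp))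

lemma mem_burnSet_of_eq_some {f : ℕ → ℕ} {V : ℕ → Option (ℤ × ℤ)} {n : ℕ} (hn : 1 ≤ n)
    {p : ℤ × ℤ} (h : V n = some p) : p ∈ burnSet f V n := by
  obtain ⟨n, rfl⟩ := Nat.exists_eq_add_of_le' hn
  exact mem_burnSet_succ.2 (.inl h)

/-- If the activators stay in squares of radius `g n`, the fire stays in squares of radius
`g n + n`. -/
lemma burnSet_subset_box {f g : ℕ → ℕ} {V : ℕ → Option (ℤ × ℤ)} (hg : Monotone g)
    (hV : ∀ n, 1 ≤ n → ∀ p, V n = some p → p ∈ box (g n)) (n : ℕ) :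
    burnSet f V n ⊆ box (g n + n) := by
  induction n with
  | zero => simp [burnSet]
  | succ n ih =>
    intro p hp
    have hmono : (g n : ℤ) ≤ g (n + 1) := by exact_mod_cast hg n.le_succ
    rw [mem_box]
    push_cast
    rcases mem_burnSet_succ.1 hp with h | h | ⟨⟨p', h', hadj⟩, -⟩
    · have := mem_box.1 (hV _ (by omega) _ h)
      omega
    · have := mem_box.1 (ih h)
      push_cast at this
      omega
    · have := mem_box.1 (ih h')
      push_cast at this
      simp only [nbrs, Finset.mem_insert, Finset.mem_singleton] at hadj
      simp only [abs_le] at this ⊢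
      rcases hadj with rfl | rfl | rfl | rfl <;> dsimp only at * <;> omega

/-- Inside a square contained in all the later grids, the fire spreads freely. -/
lemma mem_burnSet_add {f : ℕ → ℕ} (hf : Monotone f) {V : ℕ → Option (ℤ × ℤ)} {t r : ℕ}
    (hr : r ≤ f t) {p : ℤ × ℤ} (hp : p ∈ burnSet f V t) (hpr : p ∈ box r) (d : ℕ) :
    ∀ q ∈ box r, |q.1 - p.1| + |q.2 - p.2| ≤ d → q ∈ burnSet f V (t + d) := by
  induction d with
  | zero =>
    intro q _ h
    have : q = p := Prod.ext (by grind) (by grind)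
    simpa [this] using hp
  | succ d ih =>
    intro q hq h
    have hqgrid : inGrid f (t + d + 1) q := by
      have : (r : ℤ) ≤ f (t + d + 1) := by exact_mod_cast hr.trans (hf (by omega))
      exact ⟨(mem_box.1 hq).1.trans this, (mem_box.1 hq).2.trans this⟩
    by_cases hd : |q.1 - p.1| + |q.2 - p.2| ≤ d
    · exact burnSet_mono f V (by omega) (ih q hq hd)
    suffices ∃ q' ∈ box r, |q'.1 - p.1| + |q'.2 - p.2| ≤ d ∧ q ∈ nbrs q' by
      obtain ⟨q', h₁, h₂, h₃⟩ := this
      exact mem_burnSet_succ.2 (.inr (.inr ⟨⟨q', ih q' h₁ h₂, h₃⟩, hqgrid⟩))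
    obtain ⟨a, b⟩ := p
    obtain ⟨x, y⟩ := q
    simp only [mem_box, nbrs, Finset.mem_insert, Finset.mem_singleton, Prod.mk.injEq, abs_le]
      at hpr hq h hd ⊢
    push_cast at h
    rcases lt_trichotomy a x with hx | hx | hx
    · exact ⟨(x - 1, y), by dsimp only; omega, by dsimp only; grind, by simp⟩
    · rcases lt_trichotomy b y with hy | hy | hy
      · exact ⟨(x, y - 1), by dsimp only; omega, by dsimp only; grind, by simp⟩
      · subst hx hy
        simp only [sub_self, abs_zero] at hd
        omega
      · exact ⟨(x, y + 1), by dsimp only; omega, by dsimp only; grind, by simp⟩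
    · exact ⟨(x + 1, y), by dsimp only; omega, by dsimp only; grind, by simp⟩

/-- The `i`-th coordinate of a net of `N` points in `[-r, r]` of mesh `2 * r / N + 1`. -/
def netCoord (r N i : ℕ) : ℤ :=
  min (-(r : ℤ) + i * (2 * r / N + 1 : ℕ)) r

lemma abs_netCoord_le (r N i : ℕ) : |netCoord r N i| ≤ r := by
  have : (0 : ℤ) ≤ i * (2 * r / N + 1 : ℕ) := by positivity
  rw [abs_le, netCoord]
  omega

lemma exists_netCoord_near {r N : ℕ} (hN : 0 < N) {x : ℤ} (hx : |x| ≤ r) :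
    ∃ i < N, |x - netCoord r N i| ≤ (2 * r / N + 1 : ℕ) := by
  rw [abs_le] at hx
  set m := 2 * r / N + 1 with hm
  obtain ⟨y, hy⟩ : ∃ y : ℕ, (y : ℤ) = x + r := ⟨(x + r).toNat, by omega⟩
  have hyr : y < N * m := by
    have := Nat.lt_mul_div_succ (2 * r) hN
    rw [← hm] at this
    omega
  have hdiv : m * (y / m) + y % m = y := Nat.div_add_mod y m
  have hmod : y % m < m := Nat.mod_lt _ (Nat.succ_pos _)
  refine ⟨y / m, Nat.div_lt_of_lt_mul (by rwa [mul_comm]), ?_⟩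
  have hcoord : ((y / m : ℕ) : ℤ) * (m : ℕ) = y - (y % m : ℕ) := by
    rw [eq_sub_iff_add_eq, mul_comm]
    exact_mod_cast hdiv
  rw [netCoord, ← hm, hcoord, abs_le]
  clear_value m
  omega

/-- Between the times `k ^ (2 * q + 1)` and `(k + 1) ^ (2 * q + 1)`, activate a net of
`k ^ q * k ^ q` points of the square of radius `g (k ^ (2 * q + 1))`. -/
def netActivator (g : ℕ → ℕ) (q t : ℕ) : Option (ℤ × ℤ) :=
  let k := Nat.nthRoot (2 * q + 1) t
  let r := g (k ^ (2 * q + 1))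
  let j := t - k ^ (2 * q + 1)
  some (netCoord r (k ^ q) (j / k ^ q), netCoord r (k ^ q) (j % k ^ q))

lemma netActivator_mem_box {g : ℕ → ℕ} (hg : Monotone g) {q t : ℕ} {p : ℤ × ℤ}
    (h : netActivator g q t = some p) : p ∈ box (g t) := by
  obtain rfl := Option.some.inj h
  have : (g (Nat.nthRoot (2 * q + 1) t ^ (2 * q + 1)) : ℤ) ≤ g t := by
    exact_mod_cast hg (Nat.pow_nthRoot_le (.inl (by omega)))
  exact mem_box.2 ⟨(abs_netCoord_le ..).trans this, (abs_netCoord_le ..).trans this⟩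

lemma pow_add_mul_pow_le (k n : ℕ) : k ^ (n + 1) + (n + 1) * k ^ n ≤ (k + 1) ^ (n + 1) := by
  induction n with
  | zero => simp
  | succ n ih =>
    calc k ^ (n + 1 + 1) + (n + 1 + 1) * k ^ (n + 1)
        ≤ (k ^ (n + 1) + (n + 1) * k ^ n) * (k + 1) := by
          have : 0 ≤ (n + 1) * k ^ n := by positivity
          ring_nf at this ⊢
          omega
      _ ≤ (k + 1) ^ (n + 1) * (k + 1) := Nat.mul_le_mul_right _ ih
      _ = (k + 1) ^ (n + 1 + 1) := (pow_succ _ _).symm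

/-- If the mesh of the net is fine enough, the square is burned at the end of the block. -/
lemma box_subset_burnSet_netActivator {f g : ℕ → ℕ} (hf : Monotone f) (hgf : ∀ n, g n ≤ f n)
    {q k : ℕ} (hq : 1 ≤ q) (hk : 1 ≤ k)
    (hmesh : 2 * g (k ^ (2 * q + 1)) / k ^ q + 1 ≤ k ^ (2 * q)) :
    box (g (k ^ (2 * q + 1))) ⊆ burnSet f (netActivator g q) ((k + 1) ^ (2 * q + 1)) := by
  intro p hp
  have hN : 0 < k ^ q := by positivity
  obtain ⟨hp₁, hp₂⟩ := mem_box.1 hp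
  obtain ⟨a, ha, ha'⟩ := exists_netCoord_near hN hp₁
  obtain ⟨b, hb, hb'⟩ := exists_netCoord_near hN hp₂
  set r := g (k ^ (2 * q + 1)) with hr
  set m := 2 * r / k ^ q + 1
  have hj : k ^ q * a + b < k ^ (2 * q) := by
    have : k ^ q * (a + 1) ≤ k ^ q * k ^ q := Nat.mul_le_mul_left _ ha
    rw [two_mul, pow_add]
    linarith
  have hblock : k ^ (2 * q + 1) + 3 * k ^ (2 * q) ≤ (k + 1) ^ (2 * q + 1) :=
    (Nat.add_le_add_left (Nat.mul_le_mul_right _ (by omega)) _).trans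
      (pow_add_mul_pow_le k (2 * q))
  have hk' : 1 ≤ k ^ (2 * q + 1) := Nat.one_le_pow _ _ hk
  set t := k ^ (2 * q + 1) + (k ^ q * a + b) with ht
  have hroot : Nat.nthRoot (2 * q + 1) t = k :=
    Nat.nthRoot_eq_of_le_of_lt (by omega) (by omega)
  have hV : netActivator g q t = some (netCoord r (k ^ q) a, netCoord r (k ^ q) b) := by
    have h₁ : (k ^ q * a + b) / k ^ q = a := by
      rw [Nat.mul_add_div hN, Nat.div_eq_of_lt hb, add_zero]
    have h₂ : (k ^ q * a + b) % k ^ q = b := by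
      rw [Nat.mul_add_mod, Nat.mod_eq_of_lt hb]
    simp only [netActivator, hroot, ← hr]
    rw [show t - k ^ (2 * q + 1) = k ^ q * a + b by omega, h₁, h₂]
  refine burnSet_mono _ _ (show t + 2 * m ≤ _ by omega) ?_
  refine mem_burnSet_add hf ((hgf _).trans (hf (by omega)))
    (mem_burnSet_of_eq_some (by omega) hV)
    (mem_box.2 ⟨abs_netCoord_le .., abs_netCoord_le ..⟩) _ p hp ?_
  push_cast at *
  linarith

lemma tendsto_nthRoot_atTop {p : ℕ} (hp : p ≠ 0) : Tendsto (Nat.nthRoot p) atTop atTop :=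
  tendsto_atTop.2 fun b => (eventually_ge_atTop (b ^ p)).mono fun _ h => (Nat.le_nthRoot_iff hp).2 h

lemma tendsto_nthRoot_sub_one_pow_div {p : ℕ} (hp : p ≠ 0) :
    Tendsto (fun n : ℕ => (((Nat.nthRoot p n - 1) ^ p : ℕ) : ℝ) / n) atTop (nhds 1) := by
  have hlim : Tendsto (fun k : ℕ => (((k - 1 : ℕ) : ℝ) / ((k - 1 : ℕ) + 2)) ^ p) atTop (nhds 1) := by
    simpa using ((tendsto_natCast_div_add_atTop (2 : ℝ)).comp (tendsto_sub_atTop_nat 1)).pow p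
  refine tendsto_of_tendsto_of_tendsto_of_le_of_le' (hlim.comp (tendsto_nthRoot_atTop hp))
    tendsto_const_nhds ?_ ?_
  · filter_upwards [eventually_ge_atTop 1] with n hn
    have hk : 1 ≤ Nat.nthRoot p n := (Nat.le_nthRoot_iff hp).2 (by simpa using hn)
    have hlt : (n : ℝ) ≤ ((Nat.nthRoot p n - 1 : ℕ) + 2 : ℝ) ^ p := by
      have := (Nat.lt_pow_nthRoot_add_one hp n).le
      rw [show Nat.nthRoot p n + 1 = Nat.nthRoot p n - 1 + 2 by omega] at this
      exact_mod_cast this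
    have hn' : (0 : ℝ) < n := by exact_mod_cast hn
    simp only [Function.comp_apply, div_pow, Nat.cast_pow]
    gcongr
  · refine Eventually.of_forall fun n => div_le_one_of_le₀ ?_ n.cast_nonneg
    exact_mod_cast (Nat.pow_le_pow_left (Nat.sub_le _ 1) p).trans (Nat.pow_nthRoot_le (.inl hp))

section Growth

variable {c α : ℝ} {f : ℕ → ℕ}

lemma monotone_of_eq_ceil (hc : 0 < c) (hα : 1 < α)
    (hf : ∀ n, f n = ⌈c * (n : ℝ) ^ α⌉₊) : Monotone f := by
  intro m n hmn
  rw [hf, hf]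
  gcongr

lemma tendsto_div_rpow (hc : 0 < c) (hα : 1 < α) (hf : ∀ n, f n = ⌈c * (n : ℝ) ^ α⌉₊) :
    Tendsto (fun n : ℕ => (f n : ℝ) / (n : ℝ) ^ α) atTop (nhds c) := by
  simp only [hf]
  exact (tendsto_nat_ceil_mul_div_atTop hc.le).comp
    ((tendsto_rpow_atTop (by linarith)).comp tendsto_natCast_atTop_atTop)

lemma tendsto_atTop_of_eq_ceil (hc : 0 < c) (hα : 1 < α)
    (hf : ∀ n, f n = ⌈c * (n : ℝ) ^ α⌉₊) : Tendsto (fun n => (f n : ℝ)) atTop atTop := by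
  refine tendsto_atTop_mono (fun n => ?_) (Tendsto.const_mul_atTop hc
    ((tendsto_rpow_atTop (by linarith)).comp tendsto_natCast_atTop_atTop) :
    Tendsto (fun n : ℕ => c * (n : ℝ) ^ α) atTop atTop)
  rw [hf]
  exact Nat.le_ceil _

lemma tendsto_natCast_div (hc : 0 < c) (hα : 1 < α) (hf : ∀ n, f n = ⌈c * (n : ℝ) ^ α⌉₊) :
    Tendsto (fun n : ℕ => (n : ℝ) / f n) atTop (nhds 0) := by
  have h : Tendsto (fun n : ℕ => (n : ℝ) ^ (-(α - 1))) atTop (nhds 0) :=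
    (tendsto_rpow_neg_atTop (by linarith)).comp tendsto_natCast_atTop_atTop
  have := h.mul ((tendsto_div_rpow hc hα hf).inv₀ hc.ne')
  rw [zero_mul] at this
  refine this.congr' ?_
  filter_upwards [eventually_gt_atTop 0] with n hn
  have hn' : (0 : ℝ) < n := by exact_mod_cast hn
  rw [inv_div, ← mul_div_assoc, ← Real.rpow_add hn']
  simp

/-- `f` is asymptotically unchanged by passing to times `h n ~ n`. -/
lemma tendsto_comp_div (hc : 0 < c) (hα : 1 < α) (hf : ∀ n, f n = ⌈c * (n : ℝ) ^ α⌉₊)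
    {h : ℕ → ℕ} (hh : Tendsto h atTop atTop)
    (hh₁ : Tendsto (fun n => (h n : ℝ) / n) atTop (nhds 1)) :
    Tendsto (fun n => (f (h n) : ℝ) / f n) atTop (nhds 1) := by
  have hlim := tendsto_div_rpow hc hα hf
  have := ((hlim.comp hh).mul (hh₁.rpow_const (p := α) (.inl one_ne_zero))).mul
    (hlim.inv₀ hc.ne')
  rw [Real.one_rpow, mul_one, mul_inv_cancel₀ hc.ne'] at this
  refine this.congr' ?_
  filter_upwards [eventually_gt_atTop 0, hh.eventually_gt_atTop 0] with n hn hhn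
  have hn' : (0 : ℝ) < (n : ℝ) ^ α := Real.rpow_pos_of_pos (by exact_mod_cast hn) _
  have hhn' : (0 : ℝ) < (h n : ℝ) ^ α := Real.rpow_pos_of_pos (by exact_mod_cast hhn) _
  rw [Real.div_rpow (by positivity) (by positivity), Function.comp_apply]
  field_simp

lemma eventually_mesh_le (hc : 0 < c) (hα : 1 < α) (hf : ∀ n, f n = ⌈c * (n : ℝ) ^ α⌉₊)
    {g : ℕ → ℕ} (hgf : ∀ n, g n ≤ f n) {q : ℕ} (hq : (2 * q + 1) * α < 3 * q) :
    ∀ᶠ k : ℕ in atTop, 2 * g (k ^ (2 * q + 1)) / k ^ q + 1 ≤ k ^ (2 * q) := by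
  have hpow : Tendsto (fun k : ℕ => k ^ (2 * q + 1)) atTop atTop :=
    tendsto_pow_atTop (by omega)
  have h : Tendsto (fun k : ℕ => (k : ℝ) ^ (-(3 * q - (2 * q + 1) * α))) atTop (nhds 0) :=
    (tendsto_rpow_neg_atTop (by linarith)).comp tendsto_natCast_atTop_atTop
  have hlim := ((tendsto_div_rpow hc hα hf).comp hpow).mul h
  rw [mul_zero] at hlim
  filter_upwards [hlim.eventually_lt_const (show (0 : ℝ) < 1 / 2 by norm_num),
    eventually_gt_atTop 0] with k hk hk₀
  have hk₀' : (0 : ℝ) < k := by exact_mod_cast hk₀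
  have key : (f (k ^ (2 * q + 1)) : ℝ) / (k : ℝ) ^ (3 * q) < 1 / 2 := by
    refine lt_of_eq_of_lt ?_ hk
    rw [Function.comp_apply]
    have h₁ : ((k ^ (2 * q + 1) : ℕ) : ℝ) ^ α = (k : ℝ) ^ ((2 * q + 1) * α) := by
      rw [Real.rpow_mul hk₀'.le]
      norm_cast
    have h₂ : (k : ℝ) ^ (3 * q) = (k : ℝ) ^ (3 * q : ℝ) := by norm_cast
    rw [h₁, h₂, div_mul, neg_sub, Real.rpow_sub hk₀']
    congr 1
    field_simp
  rw [div_lt_iff₀ (by positivity)] at key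
  have : 2 * g (k ^ (2 * q + 1)) < k ^ (2 * q) * k ^ q := by
    have h₁ : 2 * f (k ^ (2 * q + 1)) < k ^ (3 * q) := by
      have : 2 * (f (k ^ (2 * q + 1)) : ℝ) < (k : ℝ) ^ (3 * q) := by linarith
      exact_mod_cast this
    have := hgf (k ^ (2 * q + 1))
    rw [← pow_add, show 2 * q + q = 3 * q by ring]
    omega
  exact Nat.div_lt_of_lt_mul (by rwa [mul_comm (k ^ q)])

end Growth

/-- if `f(n) = ⌈c n^α⌉` with `c > 0` and `α ∈ (1, 3/2)`,
then `P(G(f)) = [0, 1]`. -/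
theorem burning_density_intermediate (c α : ℝ) (hc : 0 < c) (hα₁ : 1 < α)
    (hα₂ : α < 3 / 2) (f : ℕ → ℕ)
    (hf : ∀ n, f n = ⌈c * (n : ℝ) ^ α⌉₊) :
    densSet f = Set.Icc 0 1 := by
  refine Set.Subset.antisymm (fun _ h => h.1) fun ρ hρ => ⟨hρ, ?_⟩
  obtain ⟨q, hq⟩ := exists_nat_gt (α / (3 - 2 * α))
  have hq₀ : 1 ≤ q := by
    have : (0 : ℝ) < q := (div_pos (by linarith) (by linarith)).trans hq
    exact_mod_cast this
  have hqα : (2 * q + 1) * α < 3 * q := by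
    rw [div_lt_iff₀ (by linarith)] at hq
    linarith
  set s := √ρ with hs
  have hs₀ : 0 ≤ s := Real.sqrt_nonneg ρ
  have hs₁ : s ≤ 1 := Real.sqrt_le_one.2 hρ.2
  set g : ℕ → ℕ := fun n => ⌊s * f n⌋₊ with hg
  have hfmono := monotone_of_eq_ceil hc hα₁ hf
  have hgmono : Monotone g := fun m n hmn => by
    have : (f m : ℝ) ≤ f n := by exact_mod_cast hfmono hmn
    simp only [hg]
    gcongr
  have hgf : ∀ n, g n ≤ f n := fun n =>
    Nat.floor_le_of_le (mul_le_of_le_one_left (f n).cast_nonneg hs₁)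
  have hbox : ∀ n, 1 ≤ n → ∀ p, netActivator g q n = some p → p ∈ box (g n) :=
    fun n _ p h => netActivator_mem_box hgmono h
  refine ⟨netActivator g q, fun n hn p h => ?_, ⟨1, le_rfl, by simp [netActivator]⟩, ?_⟩
  · have hle : (g n : ℤ) ≤ f n := by exact_mod_cast hgf n
    have hp := mem_box.1 (hbox n hn p h)
    exact ⟨hp.1.trans hle, hp.2.trans hle⟩
  set P := 2 * q + 1 with hP
  have hP₀ : P ≠ 0 := by omega
  set h : ℕ → ℕ := fun n => (Nat.nthRoot P n - 1) ^ P with hh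
  have hroot : Tendsto (fun n => Nat.nthRoot P n - 1) atTop atTop :=
    (tendsto_sub_atTop_nat 1).comp (tendsto_nthRoot_atTop hP₀)
  have hhtop : Tendsto h atTop atTop := (tendsto_pow_atTop hP₀).comp hroot
  have hftop := tendsto_atTop_of_eq_ceil hc hα₁ hf
  have hgdiv : Tendsto (fun n => (g n : ℝ) / f n) atTop (nhds s) :=
    (tendsto_nat_floor_mul_div_atTop hs₀).comp hftop
  have hden : Tendsto (fun n => (2 : ℝ) + 1 / f n) atTop (nhds 2) := by
    simpa using (hftop.inv_tendsto_atTop).const_add 2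
  -- The side of a square of radius `u n ~ s * f n`, relative to the side of the grid.
  have hratio : ∀ u : ℕ → ℝ, Tendsto (fun n => u n / f n) atTop (nhds s) →
      Tendsto (fun n => ((2 * u n + 1) / (2 * f n + 1)) ^ 2) atTop (nhds ρ) := fun u hu => by
    have := ((((hu.const_mul 2).add hftop.inv_tendsto_atTop).div hden two_ne_zero).pow 2)
    rw [add_zero, mul_div_cancel_left₀ s two_ne_zero, hs, Real.sq_sqrt hρ.1] at this
    refine this.congr' ?_
    filter_upwards [hftop.eventually_gt_atTop 0] with n hn
    simp only [Pi.div_apply, Pi.inv_apply]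
    congr 1
    field_simp
  refine tendsto_of_tendsto_of_tendsto_of_le_of_le'
    (hratio (fun n => g (h n)) ?_) (hratio (fun n => g n + n) ?_) ?_ ?_
  · have := (hgdiv.comp hhtop).mul
      (tendsto_comp_div hc hα₁ hf hhtop (tendsto_nthRoot_sub_one_pow_div hP₀))
    rw [mul_one] at this
    refine this.congr' ?_
    filter_upwards [(hftop.comp hhtop).eventually_gt_atTop 0] with n hn
    simp only [Function.comp_apply] at hn ⊢
    field_simp
  · simpa [add_div] using hgdiv.add (tendsto_natCast_div hc hα₁ hf)
  · filter_upwards [hroot.eventually (eventually_mesh_le hc hα₁ hf hgf hqα),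
      hroot.eventually_ge_atTop 1] with n hmesh hn
    have hsub := (box_subset_burnSet_netActivator hfmono hgf hq₀ hn hmesh).trans
      (burnSet_mono f _ (show _ ≤ n by
        rw [Nat.sub_add_cancel (by omega)]
        exact Nat.pow_nthRoot_le (.inl hP₀)))
    have hcard := Finset.card_le_card hsub
    rw [card_box] at hcard
    rw [densitySeq, div_pow]
    gcongr
    exact_mod_cast hcard
  · refine Eventually.of_forall fun n => ?_
    have hcard := Finset.card_le_card (burnSet_subset_box (f := f) hgmono hbox n)
    rw [card_box] at hcard
    rw [densitySeq, div_pow]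
    gcongr
    exact_mod_cast hcard
end

section
/- Let c > 0 be a real number, let α > 3/2, and let f(n) = ⌈c·n^α⌉. Then the set of achievable burning densities is P(G(f)) = {0}. -/
open Filter Asymptotics

/-- Every vertex burning at time `n` is within `ℓ^∞`-distance `n` of some vertex activated by
time `n`. -/
theorem exists_activator_near_of_mem_burnSet (f : ℕ → ℕ) (V : ℕ → Option (ℤ × ℤ)) (n : ℕ) :
    ∀ p ∈ burnSet f V n, ∃ k < n, ∃ v, V (k + 1) = some v ∧
      |p.1 - v.1| ≤ (n : ℤ) ∧ |p.2 - v.2| ≤ (n : ℤ) := by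
  induction n with
  | zero => simp [burnSet]
  | succ n ih =>
    have spread : ∀ p ∈ burnSet f V n ∪ ((burnSet f V n).biUnion nbrs).filter (inGrid f (n + 1)),
        ∃ k < n + 1, ∃ v, V (k + 1) = some v ∧
          |p.1 - v.1| ≤ ((n + 1 : ℕ) : ℤ) ∧ |p.2 - v.2| ≤ ((n + 1 : ℕ) : ℤ) := by
      intro p hp
      rw [Finset.mem_union, Finset.mem_filter, Finset.mem_biUnion] at hp
      rcases hp with hp | ⟨⟨q, hq, hpq⟩, -⟩
      · obtain ⟨k, hk, v, hv, h1, h2⟩ := ih p hp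
        exact ⟨k, by omega, v, hv, by push_cast; omega, by push_cast; omega⟩
      · obtain ⟨k, hk, v, hv, h1, h2⟩ := ih q hq
        refine ⟨k, by omega, v, hv, ?_⟩
        rw [abs_le] at h1 h2
        simp only [nbrs, Finset.mem_insert, Finset.mem_singleton] at hpq
        rcases hpq with rfl | rfl | rfl | rfl <;>
          simp only [abs_le] <;> push_cast <;> omega
    intro p hp
    rw [burnSet] at hp
    cases hV : V (n + 1) with
    | none =>
      rw [hV] at hp
      exact spread p hp
    | some v =>
      rw [hV] at hp
      rcases Finset.mem_insert.mp hp with rfl | hp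
      · exact ⟨n, by omega, p, hV, by simp only [sub_self, abs_zero]; omega,
          by simp only [sub_self, abs_zero]; omega⟩
      · exact spread p hp

theorem card_burnSet_le (f : ℕ → ℕ) (V : ℕ → Option (ℤ × ℤ)) (n : ℕ) :
    (burnSet f V n).card ≤ n * (2 * n + 1) ^ 2 := by
  let box : ℤ × ℤ → Finset (ℤ × ℤ) := fun v =>
    Finset.Icc (v.1 - n) (v.1 + n) ×ˢ Finset.Icc (v.2 - n) (v.2 + n)
  have hsub : burnSet f V n ⊆ (Finset.range n).biUnion fun k => box ((V (k + 1)).getD 0) := by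
    intro p hp
    obtain ⟨k, hk, v, hv, h1, h2⟩ := exists_activator_near_of_mem_burnSet f V n p hp
    rw [abs_le] at h1 h2
    simp only [Finset.mem_biUnion, Finset.mem_range]
    refine ⟨k, hk, ?_⟩
    simp only [box, hv, Option.getD_some, Finset.mem_product, Finset.mem_Icc]
    omega
  refine (Finset.card_le_card hsub).trans ?_
  refine (Finset.card_biUnion_le_card_mul _ _ ((2 * n + 1) ^ 2) fun k _ => ?_).trans
    (by rw [Finset.card_range])
  have hside : ∀ a : ℤ, (a + n + 1 - (a - n)).toNat = 2 * n + 1 := by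
    intro a
    omega
  simp only [box, Finset.card_product, Int.card_Icc, hside, sq, le_refl]

theorem tendsto_densitySeq_zero (c α : ℝ) (hc : 0 < c) (hα : 3 / 2 < α) (f : ℕ → ℕ)
    (hf : ∀ n, f n = ⌈c * (n : ℝ) ^ α⌉₊) (V : ℕ → Option (ℤ × ℤ)) :
    Tendsto (densitySeq f V) atTop (nhds 0) := by
  have hlim : Tendsto (fun n : ℕ => 9 / (4 * c ^ 2) * (n : ℝ) ^ (-(2 * α - 3))) atTop
      (nhds 0) := by
    simpa using ((tendsto_rpow_neg_atTop (by linarith : 0 < 2 * α - 3)).comp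
      tendsto_natCast_atTop_atTop).const_mul (9 / (4 * c ^ 2))
  refine squeeze_zero' (Eventually.of_forall fun n => by unfold densitySeq; positivity) ?_ hlim
  filter_upwards [eventually_ge_atTop 1] with n hn
  have hn1 : (1 : ℝ) ≤ n := by exact_mod_cast hn
  have hn0 : (0 : ℝ) < n := by linarith
  have hcard : ((burnSet f V n).card : ℝ) ≤ 9 * (n : ℝ) ^ 3 :=
    calc ((burnSet f V n).card : ℝ) ≤ n * (2 * n + 1) ^ 2 := by
          exact_mod_cast card_burnSet_le f V n
      _ ≤ n * (3 * n) ^ 2 := by gcongr; linarith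
      _ = 9 * (n : ℝ) ^ 3 := by ring
  have hfn : c * (n : ℝ) ^ α ≤ f n := by
    rw [hf]
    exact Nat.le_ceil _
  have hpow : (0 : ℝ) < (n : ℝ) ^ α := Real.rpow_pos_of_pos hn0 α
  have hsq : (2 * (c * (n : ℝ) ^ α)) ^ 2 ≤ (2 * (f n : ℝ) + 1) ^ 2 := by
    gcongr
    linarith
  calc densitySeq f V n ≤ 9 * (n : ℝ) ^ 3 / (2 * (c * (n : ℝ) ^ α)) ^ 2 := by
        unfold densitySeq
        gcongr
    _ = 9 / (4 * c ^ 2) * (n : ℝ) ^ (-(2 * α - 3)) := by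
        have hexp : (n : ℝ) ^ (-(2 * α - 3)) = (n : ℝ) ^ 3 / ((n : ℝ) ^ α) ^ 2 := by
          rw [show -(2 * α - 3) = (3 : ℕ) - α * (2 : ℕ) by push_cast; ring,
            Real.rpow_sub hn0, Real.rpow_natCast, Real.rpow_mul_natCast hn0.le]
        rw [hexp]
        field_simp
        ring

/-- if `f(n) = ⌈c n^α⌉` with `c > 0` and `α > 3/2`,
then `P(G(f)) = {0}`. -/
theorem burning_density_fast (c α : ℝ) (hc : 0 < c) (hα : 3 / 2 < α) (f : ℕ → ℕ)
    (hf : ∀ n, f n = ⌈c * (n : ℝ) ^ α⌉₊) :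
    densSet f = {0} := by
  have hzero := tendsto_densitySeq_zero c α hc hα f hf
  ext ρ
  simp only [densSet, HasBurningDensity, Set.mem_ofPred_eq, Set.mem_singleton_iff]
  constructor
  · rintro ⟨-, V, -, -, hV⟩
    exact tendsto_nhds_unique hV (hzero V)
  · rintro rfl
    refine ⟨by simp, fun _ => some 0, fun n _ p hp => ?_, ⟨1, le_rfl, by simp⟩, hzero _⟩
    obtain rfl : 0 = p := Option.some.inj hp
    simp [inGrid]
end
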